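/- arXiv:1306.2186 — 3 statements merged into one kernel-verified Lean document; each statement's English description precedes it below -/
import Mathlib

section
/- For every natural number d ≥ 1, every H > 0 and every c ≥ 1, set C = (√d + 1)^{H(d+1)/ln 2} · c^{H/ln 2} · e^{(d+1)H}. Then for every δ with 0 < δ < 1/(2(√d + 1)) and every real a with 0 < a ≤ c · δ^{−(d+1)}, one has a^{H / ln(1/(δ(√d+1)))} ≤ C. -/
open Real

/-- The key real-variable estimate: if `0 < δ < 1/(2(√d+1))` and
`0 < a ≤ c·δ^{-(d+1)}`, then `a^{H/ln(1/(δ(√d+1)))}` is bounded by the explicit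
constant `C = (√d+1)^{H(d+1)/ln 2} · c^{H/ln 2} · e^{(d+1)H}`. -/
theorem logHolder_exponent_bound
    (d : ℕ) (hd : 1 ≤ d) (H : ℝ) (hH : 0 < H) (c : ℝ) (hc : 1 ≤ c) :
    ∀ δ : ℝ, 0 < δ → δ < 1 / (2 * (Real.sqrt d + 1)) →
    ∀ a : ℝ, 0 < a → a ≤ c * δ ^ (-(d + 1 : ℝ)) →
    a ^ (H / Real.log (1 / (δ * (Real.sqrt d + 1)))) ≤
      (Real.sqrt d + 1) ^ (H * (d + 1) / Real.log 2) * c ^ (H / Real.log 2) *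
        Real.exp ((d + 1) * H) := by
  intro δ hδ hδlt a ha hac
  set s : ℝ := Real.sqrt d + 1 with hs
  have hs1 : 1 ≤ s := by linarith [Real.sqrt_nonneg (d : ℝ)]
  have hs0 : 0 < s := by linarith
  have hc0 : 0 < c := by linarith
  have hlog2 : 0 < Real.log 2 := Real.log_pos one_lt_two
  set L : ℝ := Real.log (1 / (δ * s)) with hL
  have hL2 : Real.log 2 ≤ L := by
    apply Real.log_le_log two_pos
    rw [lt_div_iff₀ (by positivity)] at hδlt
    rw [le_div_iff₀ (by positivity)]
    linarith
  have hL0 : 0 < L := hlog2.trans_le hL2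
  have hLeq : -Real.log δ = L + Real.log s := by
    rw [hL, one_div, Real.log_inv, Real.log_mul hδ.ne' hs0.ne']
    ring
  have hloga : Real.log a ≤ Real.log c + (d + 1) * (L + Real.log s) := by
    have h := Real.log_le_log ha hac
    rw [Real.log_mul hc0.ne' (Real.rpow_pos_of_pos hδ _).ne', Real.log_rpow hδ] at h
    rw [← hLeq]
    linarith
  have hlogc : 0 ≤ Real.log c := Real.log_nonneg hc
  have hlogs : 0 ≤ Real.log s := Real.log_nonneg hs1
  rw [Real.rpow_def_of_pos ha, Real.rpow_def_of_pos hs0, Real.rpow_def_of_pos hc0,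
    ← Real.exp_add, ← Real.exp_add, Real.exp_le_exp]
  calc Real.log a * (H / L)
      ≤ (Real.log c + (d + 1) * (L + Real.log s)) * (H / L) := by gcongr
    _ = (Real.log c + (d + 1) * Real.log s) * (H / L) + (d + 1) * H := by
        field_simp
        ring
    _ ≤ (Real.log c + (d + 1) * Real.log s) * (H / Real.log 2) + (d + 1) * H := by gcongr
    _ = _ := by ring
end

section
/- Let Q = (0,T)×Ω with Ω ⊂ ℝ^d bounded open and T < ∞, and let M be an N-function on Q̄ such that ∫_A M(t,x,|z|) dx dt < ∞ for every constant vector z ∈ ℝ^d and every measurable set A ⊆ Q of finite measure. Then the integrable simple functions are dense in L_M(Q) with respect to the modular topology: for every measurable ξ : Q → ℝ^d with ∫_Q M(t,x, α|ξ(t,x)|) dx dt → 0 as α → 0⁺, there exist a sequence (ξ_n) of integrable simple functions Q → ℝ^d and λ > 0 such that ∫_Q M(t,x, |ξ_n(t,x) − ξ(t,x)|/λ) dx dt → 0 as n → ∞. -/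
open Real Set Filter MeasureTheory
open scoped ENNReal

/-- A nonnegative convex function on `[0, ∞)` vanishing at `0` is monotone there. -/
theorem ConvexOn.monotoneOn_Ici_of_nonneg_of_zero {f : ℝ → ℝ} (hf : ConvexOn ℝ (Ici 0) f)
    (hnonneg : ∀ a, 0 ≤ a → 0 ≤ f a) (hzero : f 0 = 0) : MonotoneOn f (Ici 0) := by
  intro a ha b hb hab
  simp only [mem_Ici] at ha hb
  rcases ha.eq_or_lt with rfl | ha'
  · rw [hzero]
    exact hnonneg b hb
  have hb' : 0 < b := ha'.trans_le hab
  have hle : a / b ≤ 1 := (div_le_one hb').2 hab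
  have h := hf.2 (mem_Ici.2 le_rfl) (mem_Ici.2 hb) (sub_nonneg.2 hle) (div_nonneg ha hb)
    (sub_add_cancel 1 (a / b))
  simp only [smul_eq_mul, mul_zero, zero_add, hzero, div_mul_cancel₀ a hb'.ne'] at h
  exact h.trans (mul_le_of_le_one_left (hnonneg b hb) hle)

/-- Superposition of a Carathéodory function on a measurable set `Q` with a nonnegative
measurable function is almost everywhere measurable on `Q`. -/
theorem aemeasurable_restrict_superposition {X : Type*} [MeasurableSpace X] {μ : Measure X}
    {Q : Set X} (hQ : MeasurableSet Q) {M : X → ℝ → ℝ}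
    (hmeas : ∀ a, Measurable fun p => M p a) (hcont : ∀ p ∈ Q, ContinuousOn (M p) (Ici 0))
    {g : X → ℝ} (hg : Measurable g) (hg0 : ∀ p, 0 ≤ g p) :
    AEMeasurable (fun p => M p (g p)) (μ.restrict Q) := by
  have h : Measurable (Function.uncurry
      fun (a : ℝ) (p : X) => Q.indicator (fun p => M p (max a 0)) p) := by
    refine measurable_uncurry_of_continuous_of_measurable (fun p => ?_)
      fun a => (hmeas _).indicator hQ
    by_cases hp : p ∈ Q
    · simp only [indicator_of_mem hp]
      exact (hcont p hp).comp_continuous (by fun_prop) fun a => le_max_right a 0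
    · simp only [indicator_of_notMem hp]
      exact continuous_const
  refine ⟨_, h.comp (hg.prodMk measurable_id), ?_⟩
  filter_upwards [ae_restrict_mem hQ] with p hp
  simp [Function.uncurry, hp, max_eq_left (hg0 p)]

/-- **Density of integrable simple functions** in `L_M(Q)` with respect to the
modular topology: every `ξ ∈ L_M(Q)` is the modular limit of a sequence of
integrable simple functions. -/
theorem simple_functions_modularly_dense
    (d : ℕ) (T : ℝ) (hT : 0 < T)
    (Ω : Set (EuclideanSpace ℝ (Fin d))) (hΩopen : IsOpen Ω)
    (hΩbdd : Bornology.IsBounded Ω)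
    (Q : Set (ℝ × EuclideanSpace ℝ (Fin d)))
    (hQ : Q = Ioo 0 T ×ˢ Ω)
    (M : (ℝ × EuclideanSpace ℝ (Fin d)) → ℝ → ℝ)
    -- M is an N-function on Q̄
    (hMmeas : ∀ a : ℝ, Measurable fun p => M p a)
    (hMcont : ∀ p ∈ closure Q, ContinuousOn (M p) (Ici 0))
    (hMconv : ∀ p ∈ closure Q, ConvexOn ℝ (Ici 0) (M p))
    (hMnonneg : ∀ p ∈ closure Q, ∀ a, 0 ≤ a → 0 ≤ M p a)
    (hMzero : ∀ p ∈ closure Q, ∀ a, 0 ≤ a → (M p a = 0 ↔ a = 0))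
    (hMsuper : ∀ C : ℝ, ∃ a₀ : ℝ, ∀ a, a₀ ≤ a → ∀ p ∈ Q, C * a ≤ M p a)
    -- local integrability of M at constants
    (hMint : ∀ A : Set (ℝ × EuclideanSpace ℝ (Fin d)), A ⊆ Q → MeasurableSet A →
      volume A < ⊤ → ∀ z : EuclideanSpace ℝ (Fin d),
      ∫⁻ p in A, ENNReal.ofReal (M p ‖z‖) < ⊤)
    -- ξ ∈ L_M(Q)
    (ξ : (ℝ × EuclideanSpace ℝ (Fin d)) → EuclideanSpace ℝ (Fin d))
    (hξmeas : Measurable ξ)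
    (hξLM : Tendsto (fun α : ℝ => ∫⁻ p in Q, ENNReal.ofReal (M p (α * ‖ξ p‖)))
      (nhdsWithin 0 (Ioi 0)) (nhds 0)) :
    ∃ ξn : ℕ → ((ℝ × EuclideanSpace ℝ (Fin d)) → EuclideanSpace ℝ (Fin d)),
      (∀ n, Measurable (ξn n) ∧ (Set.range (ξn n)).Finite ∧ IntegrableOn (ξn n) Q) ∧
      ∃ lam > (0:ℝ),
        Tendsto (fun n => ∫⁻ p in Q, ENNReal.ofReal (M p (‖ξn n p - ξ p‖ / lam)))
          atTop (nhds 0) := by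
  have hQopen : IsOpen Q := hQ ▸ isOpen_Ioo.prod hΩopen
  have hQfin : volume Q < ⊤ := by
    rw [hQ]
    exact ((Metric.isBounded_Ioo 0 T).prod hΩbdd).measure_lt_top
  have : IsFiniteMeasure (volume.restrict Q) := ⟨by simpa using hQfin⟩
  have hcont : ∀ p ∈ Q, ContinuousOn (M p) (Ici 0) := fun p hp => hMcont p (subset_closure hp)
  have hzero : ∀ p ∈ Q, M p 0 = 0 := fun p hp => (hMzero p (subset_closure hp) 0 le_rfl).2 rfl
  obtain ⟨α, hα, hα0⟩ : ∃ α : ℝ,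
      ∫⁻ p in Q, ENNReal.ofReal (M p (α * ‖ξ p‖)) < 1 ∧ 0 < α :=
    ((hξLM.eventually_lt_const zero_lt_one).and self_mem_nhdsWithin).exists
  let s := SimpleFunc.approxOn ξ hξmeas univ 0 (mem_univ _)
  have hs_le : ∀ n p, ‖s n p - ξ p‖ ≤ ‖ξ p‖ := fun n p => by
    have h := SimpleFunc.edist_approxOn_le hξmeas (mem_univ 0) p n
    rw [edist_comm 0, edist_zero_right, edist_eq_enorm_sub] at h
    exact enorm_le_iff_norm_le.1 h
  have hs_lim : ∀ p, Tendsto (fun n => ‖s n p - ξ p‖ / α⁻¹) atTop (nhds 0) := fun p => by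
    have h := SimpleFunc.tendsto_approxOn hξmeas (mem_univ 0) (x := p) (by simp)
    simpa using (tendsto_iff_norm_sub_tendsto_zero.1 h).div_const α⁻¹
  have hs_nonneg : ∀ n p, 0 ≤ ‖s n p - ξ p‖ / α⁻¹ := fun n p => by positivity
  refine ⟨fun n => s n, fun n => ⟨(s n).measurable, (s n).finite_range,
    (s n).integrable_of_isFiniteMeasure⟩, α⁻¹, inv_pos.2 hα0, ?_⟩
  rw [← lintegral_zero (μ := volume.restrict Q)]
  refine tendsto_lintegral_of_dominated_convergence'
    (fun p => ENNReal.ofReal (M p (α * ‖ξ p‖))) (fun n => ?_) (fun n => ?_)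
    (hα.trans ENNReal.one_lt_top).ne ?_
  · exact (aemeasurable_restrict_superposition hQopen.measurableSet hMmeas hcont
      (((s n).measurable.sub hξmeas).norm.div_const _) (hs_nonneg n)).ennreal_ofReal
  · filter_upwards [ae_restrict_mem hQopen.measurableSet] with p hp
    refine ENNReal.ofReal_le_ofReal ((hMconv p (subset_closure hp)).monotoneOn_Ici_of_nonneg_of_zero
      (hMnonneg p (subset_closure hp)) (hzero p hp) (hs_nonneg n p)
      (mem_Ici.2 (by positivity)) ?_)
    rw [div_inv_eq_mul, mul_comm]
    exact mul_le_mul_of_nonneg_left (hs_le n p) hα0.le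
  · filter_upwards [ae_restrict_mem hQopen.measurableSet] with p hp
    have h := (hcont p hp 0 (mem_Ici.2 le_rfl)).tendsto.comp
      (tendsto_nhdsWithin_iff.2 ⟨hs_lim p, Eventually.of_forall fun n => hs_nonneg n p⟩)
    rw [hzero p hp] at h
    simpa using ENNReal.tendsto_ofReal h
end

section
/- Let Q = (0,T)×Ω with Ω ⊂ ℝ^d bounded open, T < ∞, and let M be an N-function on Q̄ such that ∫_G M(t,x,z) dx dt < ∞ for every bounded measurable set G ⊆ Q̄ and every constant z ≥ 0. Let ξ = Σ_{j=1}^{n} α_j 1_{G_j} with α_j ∈ ℝ^d and G_j ⊆ Q measurable, extended by zero outside Q. Let S ∈ C_c^∞(ℝ^{d+1}) with S ≥ 0, support in the unit ball and ∫_{ℝ^{d+1}} S = 1, and S_δ(t,x) = δ^{−(d+1)} S(t/δ, x/δ). Let Ψ^δ : Ω → ℝ^d be measurable maps with sup_{x∈Ω} |Ψ^δ(x) − x| ≤ K₂ δ for a constant K₂ > 0. Then ∫_Q M(t,x, | ∫_{ℝ^{d+1}} S_δ(s,y) ξ(t−s, Ψ^δ(x)−y) dy ds − ξ(t,x) |)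 dx dt → 0 as δ → 0⁺. -/
open Real Set Filter MeasureTheory
open scoped ENNReal

section Mollifier

variable {F V : Type*} [NormedAddCommGroup F] [NormedSpace ℝ F]

/-- The rescaling `S_δ(q) = δ⁻ⁿ S(δ⁻¹ q)`, `n = dim F`, of a kernel `S`. -/
noncomputable def rescaledKernel (S : F → ℝ) (δ : ℝ) (q : F) : ℝ :=
  (δ ^ Module.finrank ℝ F)⁻¹ * S (δ⁻¹ • q)

lemma rescaledKernel_nonneg {S : F → ℝ} (hS : ∀ q, 0 ≤ S q) {δ : ℝ} (hδ : 0 < δ) (q : F) :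
    0 ≤ rescaledKernel S δ q :=
  mul_nonneg (by positivity) (hS _)

lemma rescaledKernel_le_indicator {S : F → ℝ} {A : ℝ} (hA : ∀ q, S q ≤ A)
    (hball : Function.support S ⊆ Metric.ball 0 1) {δ : ℝ} (hδ : 0 < δ) (q : F) :
    rescaledKernel S δ q ≤
      (Metric.closedBall 0 δ).indicator (fun _ => (δ ^ Module.finrank ℝ F)⁻¹ * A) q := by
  by_cases hq : q ∈ Metric.closedBall (0 : F) δ
  · rw [indicator_of_mem hq]
    exact mul_le_mul_of_nonneg_left (hA _) (by positivity)
  · rw [indicator_of_notMem hq]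
    have h0 : S (δ⁻¹ • q) = 0 := by
      by_contra h
      have h1 := hball h
      rw [mem_ball_zero_iff, norm_smul, norm_inv, Real.norm_of_nonneg hδ.le,
        inv_mul_lt_iff₀ hδ, mul_one] at h1
      exact hq (mem_closedBall_zero_iff.2 h1.le)
    simp [rescaledKernel, h0]

variable [FiniteDimensional ℝ F] [MeasurableSpace F] [BorelSpace F]
  [NormedAddCommGroup V] [NormedSpace ℝ V]

lemma integral_rescaledKernel (μ : Measure F) [μ.IsAddHaarMeasure] (S : F → ℝ) {δ : ℝ}
    (hδ : 0 < δ) : ∫ q, rescaledKernel S δ q ∂μ = ∫ q, S q ∂μ := by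
  unfold rescaledKernel
  rw [integral_const_mul, Measure.integral_comp_inv_smul_of_nonneg μ S hδ.le, smul_eq_mul,
    ← mul_assoc, inv_mul_cancel₀ (by positivity), one_mul]

lemma integrable_rescaledKernel (μ : Measure F) [μ.IsAddHaarMeasure] {S : F → ℝ}
    (hS : Integrable S μ) {δ : ℝ} (hδ : 0 < δ) : Integrable (rescaledKernel S δ) μ :=
  (hS.comp_smul (inv_ne_zero hδ.ne')).const_mul _

lemma norm_mollification_le (μ : Measure F) [μ.IsAddHaarMeasure] {S : F → ℝ}
    (hSint : Integrable S μ) (hS1 : ∫ q, S q ∂μ = 1) (hS0 : ∀ q, 0 ≤ S q)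
    {ξ : F → V} {B : ℝ} (hB : ∀ q, ‖ξ q‖ ≤ B) {δ : ℝ} (hδ : 0 < δ) (w : F) :
    ‖∫ q, rescaledKernel S δ q • ξ (w - q) ∂μ‖ ≤ B := by
  calc ‖∫ q, rescaledKernel S δ q • ξ (w - q) ∂μ‖
      ≤ ∫ q, rescaledKernel S δ q * B ∂μ := by
        refine norm_integral_le_of_norm_le ((integrable_rescaledKernel μ hSint hδ).mul_const B)
          (ae_of_all _ fun q => ?_)
        rw [norm_smul, Real.norm_of_nonneg (rescaledKernel_nonneg hS0 hδ _)]
        exact mul_le_mul_of_nonneg_left (hB _) (rescaledKernel_nonneg hS0 hδ _)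
    _ = B := by rw [integral_mul_const, integral_rescaledKernel μ S hδ, hS1, one_mul]

variable [CompleteSpace V]

/-- The error of a mollification centred at `w` is controlled by the mean oscillation on
`closedBall w δ`. -/
lemma norm_mollification_sub_le (μ : Measure F) [μ.IsAddHaarMeasure] {S : F → ℝ} {A : ℝ}
    (hSint : Integrable S μ) (hS1 : ∫ q, S q ∂μ = 1) (hS0 : ∀ q, 0 ≤ S q)
    (hA : ∀ q, S q ≤ A) (hball : Function.support S ⊆ Metric.ball 0 1)
    {ξ : F → V} (hξ : AEStronglyMeasurable ξ μ) {B : ℝ} (hB : ∀ q, ‖ξ q‖ ≤ B)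
    {δ : ℝ} (hδ : 0 < δ) (w : F) (c : V) :
    ‖(∫ q, rescaledKernel S δ q • ξ (w - q) ∂μ) - c‖ ≤
      A * μ.real (Metric.closedBall 0 1) * ⨍ y in Metric.closedBall w δ, ‖ξ y - c‖ ∂μ := by
  have hk := (integrable_rescaledKernel μ hSint hδ).comp_sub_left w
  have hchange : ∫ q, rescaledKernel S δ q • ξ (w - q) ∂μ
      = ∫ y, rescaledKernel S δ (w - y) • ξ y ∂μ := by
    rw [← integral_sub_left_eq_self _ μ w]
    simp
  have hc : c = ∫ y, rescaledKernel S δ (w - y) • c ∂μ := by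
    rw [integral_smul_const, integral_sub_left_eq_self (rescaledKernel S δ) μ w,
      integral_rescaledKernel μ S hδ, hS1, one_smul]
  have hdiff : (∫ q, rescaledKernel S δ q • ξ (w - q) ∂μ) - c
      = ∫ y, rescaledKernel S δ (w - y) • (ξ y - c) ∂μ := by
    conv_lhs => rw [hchange, hc]
    have hkξ : Integrable (fun y => rescaledKernel S δ (w - y) • ξ y) μ :=
      hk.smul_bdd B hξ (ae_of_all _ hB)
    rw [← integral_sub hkξ (hk.smul_const c)]
    simp only [smul_sub]
  have hvol : μ (Metric.closedBall w δ) ≠ ⊤ := measure_closedBall_lt_top.ne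
  have hosc : IntegrableOn (fun y => ‖ξ y - c‖) (Metric.closedBall w δ) μ := by
    refine Measure.integrableOn_of_bounded (M := B + ‖c‖) hvol ?_ (ae_of_all _ fun y => ?_)
    · exact (hξ.sub aestronglyMeasurable_const).norm
    · rw [norm_norm]
      exact (norm_sub_le _ _).trans (by gcongr; exact hB y)
  have hreal : μ.real (Metric.closedBall w δ)
      = δ ^ Module.finrank ℝ F * μ.real (Metric.closedBall 0 1) := by
    rw [Measure.real, Measure.addHaar_closedBall' μ w hδ.le, ENNReal.toReal_mul,
      ENNReal.toReal_ofReal (by positivity), Measure.real]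
  have hpos : 0 < μ.real (Metric.closedBall w δ) :=
    ENNReal.toReal_pos (Metric.measure_closedBall_pos μ w hδ).ne' hvol
  rw [hdiff]
  calc ‖∫ y, rescaledKernel S δ (w - y) • (ξ y - c) ∂μ‖
      ≤ ∫ y, (Metric.closedBall w δ).indicator
          (fun y => (δ ^ Module.finrank ℝ F)⁻¹ * A * ‖ξ y - c‖) y ∂μ := by
        refine norm_integral_le_of_norm_le
          ((integrable_indicator_iff Metric.isClosed_closedBall.measurableSet).2
            (hosc.const_mul _))
          (ae_of_all _ fun y => ?_)
        have h := rescaledKernel_le_indicator hA hball hδ (w - y)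
        rw [norm_smul, Real.norm_of_nonneg (rescaledKernel_nonneg hS0 hδ _)]
        by_cases hy : y ∈ Metric.closedBall w δ
        · have hy' : w - y ∈ Metric.closedBall (0 : F) δ := by
            rwa [mem_closedBall_zero_iff, ← mem_closedBall_iff_norm']
          rw [indicator_of_mem hy'] at h
          rw [indicator_of_mem hy]
          gcongr
        · have hy' : w - y ∉ Metric.closedBall (0 : F) δ := by
            rwa [mem_closedBall_zero_iff, ← mem_closedBall_iff_norm']
          rw [indicator_of_notMem hy'] at h
          rw [indicator_of_notMem hy]
          exact mul_nonpos_of_nonpos_of_nonneg h (norm_nonneg _)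
    _ = A * μ.real (Metric.closedBall 0 1) * ⨍ y in Metric.closedBall w δ, ‖ξ y - c‖ ∂μ := by
        rw [integral_indicator Metric.isClosed_closedBall.measurableSet, integral_const_mul,
          setAverage_eq, smul_eq_mul, hreal]
        rw [hreal] at hpos
        have h1 : μ.real (Metric.closedBall (0 : F) 1) ≠ 0 := by
          intro h; simp [h] at hpos
        field_simp

/-- Almost everywhere convergence of mollifications with centres `w δ` moving within distance
`K δ` of the base point. -/
lemma ae_tendsto_norm_mollification_sub (μ : Measure F) [μ.IsAddHaarMeasure] {S : F → ℝ} {A : ℝ}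
    (hSint : Integrable S μ) (hS1 : ∫ q, S q ∂μ = 1) (hS0 : ∀ q, 0 ≤ S q)
    (hA : ∀ q, S q ≤ A) (hball : Function.support S ⊆ Metric.ball 0 1)
    {ξ : F → V} (hξ : LocallyIntegrable ξ μ) {B : ℝ} (hB : ∀ q, ‖ξ q‖ ≤ B) (K : ℝ) :
    ∀ᵐ p ∂μ, ∀ w : ℝ → F, (∀ δ > 0, p ∈ Metric.closedBall (w δ) (K * δ)) →
      Tendsto (fun δ => ‖(∫ q, rescaledKernel S δ q • ξ (w δ - q) ∂μ) - ξ p‖)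
        (nhdsWithin 0 (Ioi 0)) (nhds 0) := by
  filter_upwards [IsUnifLocDoublingMeasure.ae_tendsto_average_norm_sub μ hξ K] with p hp w hw
  have h := hp w id tendsto_id (eventually_mem_nhdsWithin.mono fun δ hδ => hw δ hδ)
  have h' := h.const_mul (A * μ.real (Metric.closedBall 0 1))
  rw [mul_zero] at h'
  refine tendsto_of_tendsto_of_tendsto_of_le_of_le' tendsto_const_nhds h'
    (Eventually.of_forall fun _ => norm_nonneg _)
    (eventually_mem_nhdsWithin.mono fun δ hδ => ?_)
  exact norm_mollification_sub_le μ hSint hS1 hS0 hA hball hξ.aestronglyMeasurable hB hδ _ _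

end Mollifier

lemma ConvexOn.le_div_mul_of_map_zero {f : ℝ → ℝ} (hf : ConvexOn ℝ (Ici 0) f) (h0 : f 0 = 0)
    {a c : ℝ} (ha : 0 ≤ a) (hc : 0 < c) (hac : a ≤ c) : f a ≤ a / c * f c := by
  have h1 : a / c ≤ 1 := (div_le_one hc).2 hac
  have h := hf.2 (mem_Ici.2 le_rfl) (mem_Ici.2 hc.le) (sub_nonneg.2 h1)
    (div_nonneg ha hc.le) (sub_add_cancel 1 (a / c))
  simpa [h0, div_mul_cancel₀ a hc.ne'] using h

/-- **Modular convergence of mollifications of a simple function**: for a simple function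
`ξ = Σ_j α_j 1_{G_j}` (extended by zero outside `Q`) and the shifted mollification
`(𝒮_δ ξ)(t,x) = ∫ S_δ(s,y) ξ(t−s, Ψ^δ(x)−y) dy ds`, one has
`ρ_M(𝒮_δ ξ − ξ) → 0` as `δ → 0⁺`. -/
theorem mollified_simple_function_modular_convergence
    (d : ℕ) (T : ℝ) (hT : 0 < T)
    (Ω : Set (EuclideanSpace ℝ (Fin d))) (hΩopen : IsOpen Ω)
    (hΩbdd : Bornology.IsBounded Ω)
    (Q : Set (ℝ × EuclideanSpace ℝ (Fin d)))
    (hQ : Q = Ioo 0 T ×ˢ Ω)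
    (M : (ℝ × EuclideanSpace ℝ (Fin d)) → ℝ → ℝ)
    -- M is an N-function on Q̄
    (hMmeas : ∀ a : ℝ, Measurable fun p => M p a)
    (hMcont : ∀ p ∈ closure Q, ContinuousOn (M p) (Ici 0))
    (hMconv : ∀ p ∈ closure Q, ConvexOn ℝ (Ici 0) (M p))
    (hMnonneg : ∀ p ∈ closure Q, ∀ a, 0 ≤ a → 0 ≤ M p a)
    (hMzero : ∀ p ∈ closure Q, ∀ a, 0 ≤ a → (M p a = 0 ↔ a = 0))
    (hMsuper : ∀ C : ℝ, ∃ a₀ : ℝ, ∀ a, a₀ ≤ a → ∀ p ∈ Q, C * a ≤ M p a)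
    (hMint : ∀ G : Set (ℝ × EuclideanSpace ℝ (Fin d)), MeasurableSet G →
      Bornology.IsBounded G → G ⊆ closure Q → ∀ z : ℝ, 0 ≤ z →
      ∫⁻ p in G, ENNReal.ofReal (M p z) < ⊤)
    -- the simple function ξ = Σ_{j<n} α_j 1_{G_j}, extended by zero outside Q
    (n : ℕ) (α : ℕ → EuclideanSpace ℝ (Fin d))
    (G : ℕ → Set (ℝ × EuclideanSpace ℝ (Fin d)))
    (hG : ∀ j, G j ⊆ Q) (hGmeas : ∀ j, MeasurableSet (G j))
    (ξ : (ℝ × EuclideanSpace ℝ (Fin d)) → EuclideanSpace ℝ (Fin d))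
    (hξ : ξ = fun p => ∑ j ∈ Finset.range n, (G j).indicator (fun _ => α j) p)
    -- mollification kernel S on ℝ^{d+1} = ℝ × ℝ^d
    (S : ℝ × EuclideanSpace ℝ (Fin d) → ℝ)
    (hSsmooth : ContDiff ℝ (⊤ : ℕ∞) S) (hScomp : HasCompactSupport S)
    (hSnonneg : ∀ q, 0 ≤ S q)
    (hSball : Function.support S ⊆ Metric.ball 0 1)
    (hSint : ∫ q, S q = 1)
    -- the maps Ψ^δ
    (Ψ : ℝ → EuclideanSpace ℝ (Fin d) → EuclideanSpace ℝ (Fin d))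
    (hΨmeas : ∀ δ > 0, Measurable (Ψ δ))
    (K₂ : ℝ) (hK₂ : 0 < K₂)
    (hΨclose : ∀ δ > 0, ∀ x ∈ Ω, ‖Ψ δ x - x‖ ≤ K₂ * δ) :
    Tendsto (fun δ : ℝ => ∫⁻ p in Q, ENNReal.ofReal (M p
        ‖(∫ q : ℝ × EuclideanSpace ℝ (Fin d), ((δ ^ (d+1))⁻¹ * S (q.1 / δ, δ⁻¹ • q.2)) •
            ξ (p.1 - q.1, Ψ δ p.2 - q.2)) - ξ p‖))
      (nhdsWithin 0 (Ioi 0)) (nhds 0) := by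
  have hHaar : (volume : Measure (ℝ × EuclideanSpace ℝ (Fin d))).IsAddHaarMeasure := by
    rw [Measure.volume_eq_prod]
    infer_instance
  have hfin : Module.finrank ℝ (ℝ × EuclideanSpace ℝ (Fin d)) = d + 1 := by
    simp [add_comm]
  have hker : ∀ (δ : ℝ) (q : ℝ × EuclideanSpace ℝ (Fin d)),
      (δ ^ (d + 1))⁻¹ * S (q.1 / δ, δ⁻¹ • q.2) = rescaledKernel S δ q := by
    intro δ q
    rw [rescaledKernel, hfin, div_eq_inv_mul]
    rfl
  have hSi : Integrable S := hSsmooth.continuous.integrable_of_hasCompactSupport hScomp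
  obtain ⟨A, hA⟩ := hScomp.exists_bound_of_continuous hSsmooth.continuous
  have hA' : ∀ q, S q ≤ A := fun q => (le_abs_self _).trans (hA q)
  have hQmeas : MeasurableSet Q := hQ ▸ measurableSet_Ioo.prod hΩopen.measurableSet
  have hQbdd : Bornology.IsBounded Q := hQ ▸ (Metric.isBounded_Ioo 0 T).prod hΩbdd
  have hξmeas : StronglyMeasurable ξ := by
    rw [hξ]
    exact Finset.stronglyMeasurable_fun_sum _ fun j _ =>
      stronglyMeasurable_const.indicator (hGmeas j)
  set B : ℝ := ∑ j ∈ Finset.range n, ‖α j‖ with hBdef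
  have hB0 : 0 ≤ B := Finset.sum_nonneg fun _ _ => norm_nonneg _
  have hB : ∀ p, ‖ξ p‖ ≤ B := by
    intro p
    rw [hξ]
    exact (norm_sum_le _ _).trans (Finset.sum_le_sum fun j _ => norm_indicator_le_norm_self _ _)
  have hξloc : LocallyIntegrable ξ :=
    (locallyIntegrable_const B).mono hξmeas.aestronglyMeasurable
      (ae_of_all _ fun p => (hB p).trans (le_abs_self _))
  set u : ℝ → ℝ × EuclideanSpace ℝ (Fin d) → ℝ := fun δ p =>
    ‖(∫ q, rescaledKernel S δ q • ξ ((p.1, Ψ δ p.2) - q)) - ξ p‖ with hu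
  have hC : 0 < 2 * B + 1 := by positivity
  have huB : ∀ δ > 0, ∀ p, u δ p ≤ 2 * B + 1 := by
    intro δ hδ p
    have h := norm_mollification_le volume hSi hSint hSnonneg hB hδ (p.1, Ψ δ p.2)
    linarith [norm_sub_le (∫ q, rescaledKernel S δ q • ξ ((p.1, Ψ δ p.2) - q)) (ξ p), hB p]
  have humeas : ∀ δ > 0, Measurable (u δ) := by
    intro δ hδ
    have hkm : Measurable (rescaledKernel S δ) :=
      (hSsmooth.continuous.measurable.comp (measurable_const_smul _)).const_mul _
    have hc : Measurable fun z : (ℝ × EuclideanSpace ℝ (Fin d)) × (ℝ × EuclideanSpace ℝ (Fin d)) =>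
        (z.1.1, Ψ δ z.1.2) - z.2 :=
      (measurable_fst.fst.prodMk ((hΨmeas δ hδ).comp measurable_fst.snd)).sub measurable_snd
    have hint : StronglyMeasurable fun z :
        (ℝ × EuclideanSpace ℝ (Fin d)) × (ℝ × EuclideanSpace ℝ (Fin d)) =>
        rescaledKernel S δ z.2 • ξ ((z.1.1, Ψ δ z.1.2) - z.2) :=
      ((hkm.comp measurable_snd).smul (hξmeas.measurable.comp hc)).stronglyMeasurable
    exact (hint.integral_prod_right'.sub hξmeas).norm.measurable
  have hle : ∀ δ > 0, ∀ p ∈ Q, M p (u δ p) ≤ u δ p / (2 * B + 1) * M p (2 * B + 1) :=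
    fun δ hδ p hp => (hMconv p (subset_closure hp)).le_div_mul_of_map_zero
      ((hMzero p (subset_closure hp) 0 le_rfl).2 rfl) (norm_nonneg _) hC (huB δ hδ p)
  have hlim : Tendsto (fun δ => ∫⁻ p in Q,
      ENNReal.ofReal (u δ p / (2 * B + 1) * M p (2 * B + 1)))
      (nhdsWithin 0 (Ioi 0)) (nhds (∫⁻ _ in Q, 0)) := by
    refine tendsto_lintegral_filter_of_dominated_convergence
      (fun p => ENNReal.ofReal (M p (2 * B + 1))) ?_ ?_
      (hMint Q hQmeas hQbdd subset_closure _ hC.le).ne ?_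
    · filter_upwards [self_mem_nhdsWithin] with δ hδ
      exact (((humeas δ hδ).div_const _).mul (hMmeas _)).ennreal_ofReal
    · filter_upwards [self_mem_nhdsWithin] with δ hδ
      refine (ae_restrict_iff' hQmeas).2 (ae_of_all _ fun p hp => ENNReal.ofReal_le_ofReal ?_)
      exact mul_le_of_le_one_left (hMnonneg p (subset_closure hp) _ hC.le)
        ((div_le_one hC).2 (huB δ hδ p))
    · refine (ae_restrict_iff' hQmeas).2 ?_
      filter_upwards [ae_tendsto_norm_mollification_sub volume hSi hSint hSnonneg hA' hSball
        hξloc hB K₂] with p hp hpQ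
      have hconv : Tendsto (fun δ => u δ p) (nhdsWithin 0 (Ioi 0)) (nhds 0) := by
        refine hp (fun δ => (p.1, Ψ δ p.2)) fun δ hδ => ?_
        have hx : p.2 ∈ Ω := by rw [hQ] at hpQ; exact hpQ.2
        rw [mem_closedBall_iff_norm', Prod.norm_def]
        refine max_le ?_ (hΨclose δ hδ _ hx)
        simpa using (mul_pos hK₂ hδ).le
      have h := ENNReal.tendsto_ofReal
        ((hconv.div_const (2 * B + 1)).mul_const (M p (2 * B + 1)))
      simpa using h
  rw [lintegral_zero] at hlim
  refine tendsto_of_tendsto_of_tendsto_of_le_of_le' tendsto_const_nhds hlim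
    (Eventually.of_forall fun _ => zero_le) ?_
  filter_upwards [self_mem_nhdsWithin] with δ hδ
  refine setLIntegral_mono' hQmeas fun p hp => ENNReal.ofReal_le_ofReal ?_
  simp only [hker]
  exact hle δ hδ p hp
end
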